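/- arXiv:0905.3924 — 2 statements merged into one kernel-verified Lean document; each statement's English description precedes it below -/
import Mathlib

section
/- Let n ≥ 1 and let A_c, A_0 be real symmetric n×n matrices with all entries of A_0 nonnegative. For z ∈ {-1,1}ⁿ let Δ(z) denote the diagonal matrix with diagonal entries z₁,…,zₙ, and set A_z = A_c - Δ(z) A_0 Δ(z). Then the following are equivalent: (i) every symmetric real n×n matrix B satisfying |B_{ij} - (A_c)_{ij}| ≤ (A_0)_{ij} for all i, j is positive definite; (ii) for every z ∈ {-1,1}ⁿ the matrix A_z is positive definite. -/
/-- Rohn's characterization of positive definiteness of symmetric interval matrices: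
the interval matrix `A = A_c + [-1,1]·A_0` is positive definite (i.e. every symmetric
matrix `B` with `|B i j - A_c i j| ≤ A_0 i j` is positive definite) if and only if for
every sign vector `z ∈ {-1,1}ⁿ` the matrix `A_z = A_c - Δ(z) A_0 Δ(z)` is positive
definite. -/
theorem stmt_7 (n : ℕ) (hn : 1 ≤ n) (Ac A0 : Matrix (Fin n) (Fin n) ℝ)
    (hAc : Ac.IsSymm) (hA0 : A0.IsSymm) (hA0nonneg : ∀ i j, 0 ≤ A0 i j) :
    (∀ B : Matrix (Fin n) (Fin n) ℝ, B.IsSymm →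
        (∀ i j, |B i j - Ac i j| ≤ A0 i j) → B.PosDef) ↔
      (∀ z : Fin n → ℝ, (∀ i, z i = 1 ∨ z i = -1) →
        (Ac - Matrix.diagonal z * A0 * Matrix.diagonal z).PosDef) := by
  constructor
  · intro h z hz
    refine h _ ?_ ?_
    · ext i j
      simp only [Matrix.transpose_apply, Matrix.sub_apply, Matrix.mul_diagonal,
        Matrix.diagonal_mul, hAc.apply i j, hA0.apply i j]
      ring
    · intro i j
      simp only [Matrix.sub_apply, Matrix.mul_diagonal, Matrix.diagonal_mul]
      have h0 := hA0nonneg i j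
      rcases hz i with hi | hi <;> rcases hz j with hj | hj <;> rw [hi, hj, abs_le] <;>
        constructor <;> linarith
  · intro h B hB hBA
    refine Matrix.PosDef.of_dotProduct_mulVec_pos (by simpa [Matrix.IsHermitian] using hB.eq) ?_
    intro x hx
    obtain ⟨z, hz, hzx⟩ : ∃ z : Fin n → ℝ, (∀ i, z i = 1 ∨ z i = -1) ∧
        ∀ i, z i * x i = |x i| := by
      refine ⟨fun i => if 0 ≤ x i then 1 else -1, fun i => ?_, fun i => ?_⟩
      · by_cases hi : 0 ≤ x i <;> simp [hi]
      · by_cases hi : 0 ≤ x i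
        · simp [hi, abs_of_nonneg hi]
        · simp [hi, abs_of_neg (not_le.mp hi)]
    refine lt_of_lt_of_le ((h z hz).dotProduct_mulVec_pos hx) ?_
    simp only [dotProduct, Matrix.mulVec, Finset.mul_sum]
    refine Finset.sum_le_sum fun i _ => Finset.sum_le_sum fun j _ => ?_
    simp only [Matrix.sub_apply, Matrix.mul_diagonal, Matrix.diagonal_mul, Pi.star_apply,
      star_trivial]
    have h1 : |(B i j - Ac i j) * (x i * x j)| ≤ A0 i j * (|x i| * |x j|) := by
      rw [abs_mul, abs_mul]
      exact mul_le_mul_of_nonneg_right (hBA i j) (by positivity)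
    have h2 := (abs_le.mp h1).1
    rw [← hzx i, ← hzx j] at h2
    linarith
end

section
/- Let a₀ = 1.3145271093265, b₀ = -0.3, x₀ = (1/2)(b₀ - √((b₀-1)² + 4a₀) - 1), z₀ = (x₀, x₀), u₀ = (-x₀ + √(x₀² + b₀), 1)/‖(-x₀ + √(x₀² + b₀), 1)‖, s₀ = (-x₀ - √(x₀² + b₀), 1)/‖(-x₀ - √(x₀² + b₀), 1)‖ (Euclidean norm), and z₁ = z₀ + 0.0001993152279412426·u₀ + 2.50404·10⁻¹¹·s₀. Then the 14-th iterate of the Hénon map satisfies ‖H_{a₀,b₀}¹⁴(z₁) - z₀‖ ≤ 1.2·10⁻⁵. -/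
/-- The Hénon map `H_{a,b}(x,y) = (a - x² + b y, x)`. -/
noncomputable def henon (a b : ℝ) (p : ℝ × ℝ) : ℝ × ℝ :=
  (a - p.1 ^ 2 + b * p.2, p.1)

/-- The Euclidean norm on `ℝ²`. -/
noncomputable def enorm2 (p : ℝ × ℝ) : ℝ := Real.sqrt (p.1 ^ 2 + p.2 ^ 2)


/-- Enclosure of a square root. -/
lemma sqrt_encl {t l u : ℝ} (_hl : 0 ≤ l) (hu : 0 ≤ u) (h1 : l ^ 2 ≤ t) (h2 : t ≤ u ^ 2) :
    l ≤ Real.sqrt t ∧ Real.sqrt t ≤ u :=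
  ⟨Real.le_sqrt_of_sq_le h1, (Real.sqrt_le_left hu).mpr h2⟩

/-- Enclosure of the components of a normalized vector `(t, 1)`. -/
lemma quot_encl {t l u nl nu : ℝ} (p1 p2 q1 q2 : ℝ) (hl : 0 ≤ l) (hnl : 0 < nl) (hlt : l ≤ t)
    (htu : t ≤ u) (h1 : nl ^ 2 ≤ l ^ 2 + 1) (h2 : u ^ 2 + 1 ≤ nu ^ 2) (hnu : 0 < nu)
    (e1 : p1 * nu ≤ l) (e2 : u ≤ p2 * nl) (e3 : q1 * nu ≤ 1) (e4 : 1 ≤ q2 * nl)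
    (hp1 : 0 ≤ p1) (hp2 : 0 ≤ p2) (hq1 : 0 ≤ q1) (hq2 : 0 ≤ q2) :
    (p1 ≤ t / enorm2 (t, 1) ∧ t / enorm2 (t, 1) ≤ p2) ∧
      (q1 ≤ 1 / enorm2 (t, 1) ∧ 1 / enorm2 (t, 1) ≤ q2) := by
  have hs : nl ≤ enorm2 (t, 1) ∧ enorm2 (t, 1) ≤ nu := by
    unfold enorm2
    apply sqrt_encl hnl.le hnu.le
    · have := pow_le_pow_left₀ hl hlt 2
      simp only [one_pow]
      linarith
    · have := pow_le_pow_left₀ (hl.trans hlt) htu 2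
      simp only [one_pow]
      linarith
  obtain ⟨ha, hb⟩ := hs
  have hpos : 0 < enorm2 (t, 1) := hnl.trans_le ha
  refine ⟨⟨?_, ?_⟩, ?_, ?_⟩
  · rw [le_div_iff₀ hpos]
    exact ((mul_le_mul_of_nonneg_left hb hp1).trans e1).trans hlt
  · rw [div_le_iff₀ hpos]
    exact htu.trans (e2.trans (mul_le_mul_of_nonneg_left ha hp2))
  · rw [le_div_iff₀ hpos]
    exact (mul_le_mul_of_nonneg_left hb hq1).trans e3
  · rw [div_le_iff₀ hpos]
    exact e4.trans (mul_le_mul_of_nonneg_left ha hq2)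

/-- One step of the map in centre-radius interval arithmetic. -/
lemma henon_step {a : ℝ} {p : ℝ × ℝ} {X Y e f : ℝ} (Xn en : ℝ)
    (hp : |p.1 - X| ≤ e ∧ |p.2 - Y| ≤ f)
    (h : |a - X ^ 2 + (-0.3) * Y - Xn| + (2 * |X| * e + e ^ 2 + 0.3 * f) ≤ en) :
    |(henon a (-0.3) p).1 - Xn| ≤ en ∧ |(henon a (-0.3) p).2 - X| ≤ e := by
  obtain ⟨h1, h2⟩ := hp
  refine ⟨?_, h1⟩
  have he : 0 ≤ e := (abs_nonneg _).trans h1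
  have key : (henon a (-0.3) p).1 - Xn =
      (a - X ^ 2 + (-0.3) * Y - Xn) + (-(2 * X * (p.1 - X)) + (-((p.1 - X) ^ 2)
        + (-0.3) * (p.2 - Y))) := by
    simp only [henon]; ring
  rw [key]
  have b1 : |-(2 * X * (p.1 - X))| ≤ 2 * |X| * e := by
    rw [abs_neg, abs_mul, abs_mul, abs_two]
    exact mul_le_mul_of_nonneg_left h1 (by positivity)
  have b2 : |-((p.1 - X) ^ 2)| ≤ e ^ 2 := by
    rw [abs_neg, abs_pow]
    exact pow_le_pow_left₀ (abs_nonneg _) h1 2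
  have b3 : |(-0.3) * (p.2 - Y)| ≤ 0.3 * f := by
    rw [abs_mul, show |(-0.3 : ℝ)| = 0.3 by norm_num]
    exact mul_le_mul_of_nonneg_left h2 (by norm_num)
  have t1 := abs_add_le (a - X ^ 2 + (-0.3) * Y - Xn) (-(2 * X * (p.1 - X)) + (-((p.1 - X) ^ 2)
        + (-0.3) * (p.2 - Y)))
  have t2 := abs_add_le (-(2 * X * (p.1 - X))) (-((p.1 - X) ^ 2) + (-0.3) * (p.2 - Y))
  have t3 := abs_add_le (-((p.1 - X) ^ 2)) ((-0.3) * (p.2 - Y))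
  linarith

theorem stmt_9 :
    let a₀ : ℝ := 1.3145271093265
    let b₀ : ℝ := -0.3
    let x₀ : ℝ := (1 / 2) * (b₀ - Real.sqrt ((b₀ - 1) ^ 2 + 4 * a₀) - 1)
    let z₀ : ℝ × ℝ := (x₀, x₀)
    let u₀ : ℝ × ℝ :=
      ((-x₀ + Real.sqrt (x₀ ^ 2 + b₀)) / enorm2 (-x₀ + Real.sqrt (x₀ ^ 2 + b₀), 1),
        1 / enorm2 (-x₀ + Real.sqrt (x₀ ^ 2 + b₀), 1))
    let s₀ : ℝ × ℝ :=
      ((-x₀ - Real.sqrt (x₀ ^ 2 + b₀)) / enorm2 (-x₀ - Real.sqrt (x₀ ^ 2 + b₀), 1),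
        1 / enorm2 (-x₀ - Real.sqrt (x₀ ^ 2 + b₀), 1))
    let z₁ : ℝ × ℝ := z₀ + (0.0001993152279412426 : ℝ) • u₀ + (2.50404e-11 : ℝ) • s₀
    enorm2 ((henon a₀ b₀)^[14] z₁ - z₀) ≤ 1.2e-5 := by
  intro a₀ b₀ x₀ z₀ u₀ s₀ z₁
  have hs : (2.63592648556555916707975693573478 : ℝ) ≤ Real.sqrt ((b₀ - 1) ^ 2 + 4 * a₀) ∧
      Real.sqrt ((b₀ - 1) ^ 2 + 4 * a₀) ≤ (2.63592648556555916707975693573498 : ℝ) := by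
    apply sqrt_encl <;> norm_num [a₀, b₀]
  have hx : (-1.96796324278277958353987846786754 : ℝ) ≤ x₀ ∧ x₀ ≤ (-1.96796324278277958353987846786734 : ℝ) := by
    have e : x₀ = (1 / 2) * (-0.3 - Real.sqrt ((b₀ - 1) ^ 2 + 4 * a₀) - 1) := rfl
    rw [e]
    constructor <;> linarith [hs.1, hs.2]
  clear hs
  have hx2 : (-1.96796324278277958353987846786734 : ℝ) ^ 2 ≤ x₀ ^ 2 ∧ x₀ ^ 2 ≤ (-1.96796324278277958353987846786754 : ℝ) ^ 2 := by
    obtain ⟨h1, h2⟩ := hx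
    constructor <;> nlinarith
  have hr : (1.89020615937630291560705842667015 : ℝ) ≤ Real.sqrt (x₀ ^ 2 + b₀) ∧ Real.sqrt (x₀ ^ 2 + b₀) ≤ (1.89020615937630291560705842667215 : ℝ) := by
    have e : b₀ = -0.3 := rfl
    rw [e]
    apply sqrt_encl
    · norm_num
    · norm_num
    · linarith [hx2.1]
    · linarith [hx2.2]
  clear hx2
  have hu : (3.85816940215908249914693689453659 : ℝ) ≤ -x₀ + Real.sqrt (x₀ ^ 2 + b₀) ∧
      -x₀ + Real.sqrt (x₀ ^ 2 + b₀) ≤ (3.85816940215908249914693689454059 : ℝ) := by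
    constructor <;> linarith [hx.1, hx.2, hr.1, hr.2]
  have hv : (0.07775708340647666793282004119430 : ℝ) ≤ -x₀ - Real.sqrt (x₀ ^ 2 + b₀) ∧
      -x₀ - Real.sqrt (x₀ ^ 2 + b₀) ≤ (0.07775708340647666793282004119830 : ℝ) := by
    constructor <;> linarith [hx.1, hx.2, hr.1, hr.2]
  have hU : ((0.96801311777142180423304439872566 : ℝ) ≤ u₀.1 ∧ u₀.1 ≤ (0.96801311777142180423304439876566 : ℝ)) ∧
      ((0.25089958912371988962248874627939 : ℝ) ≤ u₀.2 ∧ u₀.2 ≤ (0.25089958912371988962248874631939 : ℝ)) := by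
    refine quot_encl (nl := (3.98565818099803587073215065564180 : ℝ)) (nu := (3.98565818099803587073215065564980 : ℝ)) _ _ _ _
      ?_ ?_ hu.1 hu.2 ?_ ?_ ?_ ?_ ?_ ?_ ?_ ?_ ?_ ?_ ?_ <;> norm_num
  have hV : ((0.07752307795993338307179730334707 : ℝ) ≤ s₀.1 ∧ s₀.1 ≤ (0.07752307795993338307179730338707 : ℝ)) ∧
      ((0.99699055782069375169794049924676 : ℝ) ≤ s₀.2 ∧ s₀.2 ≤ (0.99699055782069375169794049928676 : ℝ)) := by
    refine quot_encl (nl := (1.00301852625955108485697499900916 : ℝ)) (nu := (1.00301852625955108485697499901716 : ℝ)) _ _ _ _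
      ?_ ?_ hv.1 hv.2 ?_ ?_ ?_ ?_ ?_ ?_ ?_ ?_ ?_ ?_ ?_ <;> norm_num
  obtain ⟨⟨hU1, hU2⟩, hU3, hU4⟩ := hU
  obtain ⟨⟨hV1, hV2⟩, hV3, hV4⟩ := hV
  have k0 : |z₁.1 - (-1.96777030302561965080370181391202)| ≤ 0.000000000000000000000000000001 ∧ |z₁.2 - (-1.96791323464901798283333490492807)| ≤ 0.000000000000000000000000000001 := by
    have e1 : z₁.1 = x₀ + 0.0001993152279412426 * u₀.1 + 0.0000000000250404 * s₀.1 := rfl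
    have e2 : z₁.2 = x₀ + 0.0001993152279412426 * u₀.2 + 0.0000000000250404 * s₀.2 := rfl
    rw [e1, e2]
    obtain ⟨hx1, hx2⟩ := hx
    constructor <;> rw [abs_le] <;> constructor <;> linarith
  clear hU1 hU2 hU3 hU4 hV1 hV2 hV3 hV4 hu hv hr
  have ea : a₀ = 1.3145271093265 := rfl
  have eb : b₀ = -0.3 := rfl
  have k1 := henon_step (a := 1.3145271093265) (-1.96721888574833359020016491879550) 0.0000000000000000000000000000043 k0 (by norm_num [abs_of_nonneg, abs_of_neg])
  have k2 := henon_step (a := 1.3145271093265) (-1.96509194421072927216212333478625) 0.000000000000000000000000000018 k1 (by norm_num [abs_of_nonneg, abs_of_neg])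
  clear k1
  have k3 := henon_step (a := 1.3145271093265) (-1.95689357415090384916590140475308) 0.000000000000000000000000000073 k2 (by norm_num [abs_of_nonneg, abs_of_neg])
  clear k2
  have k4 := henon_step (a := 1.3145271093265) (-1.92537776796338023982337040901497) 0.00000000000000000000000000030 k3 (by norm_num [abs_of_nonneg, abs_of_neg])
  clear k3
  have k5 := henon_step (a := 1.3145271093265) (-1.80548436779587692502442185010244) 0.0000000000000000000000000012 k4 (by norm_num [abs_of_nonneg, abs_of_neg])
  clear k4
  have k6 := henon_step (a := 1.3145271093265) (-1.36763336263976331006165844422818) 0.0000000000000000000000000045 k5 (by norm_num [abs_of_nonneg, abs_of_neg])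
  clear k5
  have k7 := henon_step (a := 1.3145271093265) (-0.01424859494008326014971926862127) 0.000000000000000000000000013 k6 (by norm_num [abs_of_nonneg, abs_of_neg])
  clear k6
  have k8 := henon_step (a := 1.3145271093265) (1.72461409566066242673460153910961) 0.0000000000000000000000000018 k7 (by norm_num [abs_of_nonneg, abs_of_neg])
  clear k7
  have k9 := henon_step (a := 1.3145271093265) (-1.65549209114291951375835633862671) 0.000000000000000000000000011 k8 (by norm_num [abs_of_nonneg, abs_of_neg])
  clear k8
  have k10 := henon_step (a := 1.3145271093265) (-1.94351118320845525839385565665829) 0.000000000000000000000000037 k9 (by norm_num [abs_of_nonneg, abs_of_neg])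
  clear k9
  have k11 := henon_step (a := 1.3145271093265) (-1.96606098258695388660317286757044) 0.00000000000000000000000015 k10 (by norm_num [abs_of_nonneg, abs_of_neg])
  clear k10
  have k12 := henon_step (a := 1.3145271093265) (-1.96781532296174201619385955266366) 0.00000000000000000000000061 k11 (by norm_num [abs_of_nonneg, abs_of_neg])
  clear k11
  have k13 := henon_step (a := 1.3145271093265) (-1.96795174118043886949889374553674) 0.0000000000000000000000025 k12 (by norm_num [abs_of_nonneg, abs_of_neg])
  clear k12
  have k14 := henon_step (a := 1.3145271093265) (-1.96796234940009845092323980803303) 0.000000000000000000000011 k13 (by norm_num [abs_of_nonneg, abs_of_neg])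
  clear k13
  set q : ℝ × ℝ := (henon a₀ b₀)^[14] z₁ with hq
  have k : |q.1 - (-1.96796234940009845092323980803303)| ≤ 0.000000000000000000000011 ∧ |q.2 - (-1.96795174118043886949889374553674)| ≤ 0.0000000000000000000000025 := k14
  clear k14
  obtain ⟨c1, c2⟩ := k
  rw [abs_le] at c1 c2
  obtain ⟨hx1, hx2⟩ := hx
  unfold enorm2
  rw [Real.sqrt_le_left (by norm_num)]
  have d1 : |(q - z₀).1| ≤ 0.0000009 := by
    have e1 : (q - z₀).1 = q.1 - x₀ := rfl
    rw [e1, abs_le]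
    constructor <;> linarith [c1.1, c1.2]
  have d2 : |(q - z₀).2| ≤ 0.00001151 := by
    have e1 : (q - z₀).2 = q.2 - x₀ := rfl
    rw [e1, abs_le]
    constructor <;> linarith [c2.1, c2.2]
  rw [← sq_abs (q - z₀).1, ← sq_abs (q - z₀).2]
  have f1 := pow_le_pow_left₀ (abs_nonneg _) d1 2
  have f2 := pow_le_pow_left₀ (abs_nonneg _) d2 2
  norm_num at f1 f2 ⊢
  linarith
end
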